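/- Let A be a real n×n symmetric positive definite matrix and 1 ≤ k ≤ n. Then the maximum defining H_k(A) is attained at the largest eigenvalue: H_k(A) = σ_{k−1;n}(λ(A))λ_n(A)/σ_k(λ(A)). Moreover, k/n ≤ H_k(A) < 1 whenever 1 ≤ k ≤ n−1, and H_n(A) = 1. -/

import Mathlib

open scoped BigOperators
open Filter MeasureTheory

noncomputable section

/-- The `j`-th elementary symmetric function of `lam ∈ ℝⁿ`. -/
def esym (n j : ℕ) (lam : Fin n → ℝ) : ℝ :=
  ∑ S ∈ Finset.powersetCard j (Finset.univ : Finset (Fin n)), ∏ i ∈ S, lam i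

/-- `σ_{j;i}`: the `j`-th elementary symmetric function with the `i`-th variable set to `0`. -/
def esymRem (n j : ℕ) (lam : Fin n → ℝ) (i : Fin n) : ℝ :=
  esym n j (Function.update lam i 0)

/-- The increasingly ordered eigenvalue vector of a real symmetric matrix
(junk value `0` if the matrix is not symmetric). -/
def eigs {n : ℕ} (M : Matrix (Fin n) (Fin n) ℝ) : Fin n → ℝ :=
  if h : M.IsHermitian then h.eigenvalues ∘ (Tuple.sort h.eigenvalues) else 0

/-- The Hessian matrix `D²u(x)` of `u : ℝⁿ → ℝ`. -/
def hessianMatrix {n : ℕ} (u : EuclideanSpace ℝ (Fin n) → ℝ) (x : EuclideanSpace ℝ (Fin n)) :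
    Matrix (Fin n) (Fin n) ℝ :=
  fun i j =>
    fderiv ℝ (fun y => fderiv ℝ u y (EuclideanSpace.single j 1)) x (EuclideanSpace.single i 1)

/-- The quadratic form `½ xᵀ A x`. -/
def quadForm {n : ℕ} (A : Matrix (Fin n) (Fin n) ℝ) (x : EuclideanSpace ℝ (Fin n)) : ℝ :=
  (1 / 2) * ∑ i, ∑ j, A i j * x i * x j

/-- The Gårding cone `Γ_k = {λ : σ_j(λ) > 0, 1 ≤ j ≤ k}`. -/
def GammaK (n k : ℕ) : Set (Fin n → ℝ) :=
  {lam | ∀ j, 1 ≤ j → j ≤ k → 0 < esym n j lam}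

/-- The Hessian quotient operator `S_{k,l}(M) = σ_k(λ(M))/σ_l(λ(M))`. -/
def Skl (n k l : ℕ) (M : Matrix (Fin n) (Fin n) ℝ) : ℝ :=
  esym n k (eigs M) / esym n l (eigs M)

/-- `H_k(A) = max_i σ_{k-1;i}(λ(A)) λ_i(A) / σ_k(λ(A))`. -/
def Hk (n k : ℕ) (A : Matrix (Fin n) (Fin n) ℝ) : ℝ :=
  ⨆ i : Fin n, esymRem n (k - 1) (eigs A) i * eigs A i / esym n k (eigs A)

/-- `ψ` is admissible on the open set `A` with respect to the cone `Γ`: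
it is `C²` on `A` and `λ(D²ψ) ∈ Γ` there. -/
def Admissible {n : ℕ} (Γ : Set (Fin n → ℝ)) (A : Set (EuclideanSpace ℝ (Fin n)))
    (ψ : EuclideanSpace ℝ (Fin n) → ℝ) : Prop :=
  ContDiffOn ℝ 2 ψ A ∧ ∀ x ∈ A, eigs (hessianMatrix ψ x) ∈ Γ

/-- Viscosity subsolution of `F(D²u) = g` on `Ω` (for `F` of the form `f(λ(D²u))`). -/
def ViscSubsolution {n : ℕ} (Γ : Set (Fin n → ℝ)) (F : Matrix (Fin n) (Fin n) ℝ → ℝ)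
    (g : EuclideanSpace ℝ (Fin n) → ℝ) (Ω : Set (EuclideanSpace ℝ (Fin n)))
    (u : EuclideanSpace ℝ (Fin n) → ℝ) : Prop :=
  UpperSemicontinuousOn u Ω ∧
    ∀ Aset : Set (EuclideanSpace ℝ (Fin n)), Aset ⊆ Ω → IsOpen Aset →
      ∀ ψ : EuclideanSpace ℝ (Fin n) → ℝ, Admissible Γ Aset ψ →
        ∀ x₀ ∈ Aset, IsLocalMaxOn (fun y => u y - ψ y) Aset x₀ →
          g x₀ ≤ F (hessianMatrix ψ x₀)

/-- Viscosity supersolution of `F(D²u) = g` on `Ω`. -/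
def ViscSupersolution {n : ℕ} (Γ : Set (Fin n → ℝ)) (F : Matrix (Fin n) (Fin n) ℝ → ℝ)
    (g : EuclideanSpace ℝ (Fin n) → ℝ) (Ω : Set (EuclideanSpace ℝ (Fin n)))
    (u : EuclideanSpace ℝ (Fin n) → ℝ) : Prop :=
  LowerSemicontinuousOn u Ω ∧
    ∀ Aset : Set (EuclideanSpace ℝ (Fin n)), Aset ⊆ Ω → IsOpen Aset →
      ∀ ψ : EuclideanSpace ℝ (Fin n) → ℝ, Admissible Γ Aset ψ →
        ∀ x₀ ∈ Aset, IsLocalMinOn (fun y => u y - ψ y) Aset x₀ →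
          F (hessianMatrix ψ x₀) ≤ g x₀

end

theorem esym_nonneg {n : ℕ} (j : ℕ) {lam : Fin n → ℝ} (h : ∀ i, 0 ≤ lam i) :
    0 ≤ esym n j lam :=
  Finset.sum_nonneg fun _ _ => Finset.prod_nonneg fun i _ => h i

theorem esym_pos {n j : ℕ} (hj : j ≤ n) {lam : Fin n → ℝ} (h : ∀ i, 0 < lam i) :
    0 < esym n j lam :=
  Finset.sum_pos (fun _ _ => Finset.prod_pos fun i _ => h i)
    (Finset.powersetCard_nonempty.2 (by simpa using hj))

theorem update_zero_nonneg {n : ℕ} {lam : Fin n → ℝ} (h : ∀ i, 0 ≤ lam i) (i l : Fin n) :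
    0 ≤ Function.update lam i 0 l := by
  by_cases hl : l = i
  · simp [hl]
  · simpa [hl] using h l

theorem esymRem_pos {n j : ℕ} (hj : j ≤ n - 1) {lam : Fin n → ℝ} (h : ∀ i, 0 < lam i)
    (i : Fin n) : 0 < esymRem n j lam i := by
  obtain ⟨S, hS, hcard⟩ := Finset.exists_subset_card_eq
    (s := Finset.univ.erase i) (n := j) (by simpa using hj)
  refine Finset.sum_pos' (fun T _ => Finset.prod_nonneg fun l _ =>
    update_zero_nonneg (fun l => (h l).le) i l)
    ⟨S, Finset.mem_powersetCard_univ.2 hcard, ?_⟩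
  refine Finset.prod_pos fun l hl => ?_
  rw [Function.update_of_ne (Finset.ne_of_mem_erase (hS hl))]
  exact h l

theorem esymRem_self (n : ℕ) (lam : Fin n → ℝ) (i : Fin n) : esymRem n n lam i = 0 := by
  rw [esymRem, esym]
  refine Finset.sum_eq_zero fun S hS => ?_
  have hS' : S = Finset.univ := by
    rw [← Finset.card_eq_iff_eq_univ]
    simpa using (Finset.mem_powersetCard.1 hS).2
  subst hS'
  exact Finset.prod_eq_zero (Finset.mem_univ i) (Function.update_self i 0 lam)

theorem esymRem_eq_sum_filter (n j : ℕ) (lam : Fin n → ℝ) (i : Fin n) :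
    esymRem n j lam i =
      ∑ S ∈ Finset.powersetCard j (Finset.univ : Finset (Fin n)) with i ∉ S, ∏ l ∈ S, lam l := by
  rw [esymRem, esym, Finset.sum_filter]
  refine Finset.sum_congr rfl fun S _ => ?_
  split_ifs with hi
  · exact Finset.prod_eq_zero hi (Function.update_self i 0 lam)
  · exact Finset.prod_congr rfl fun l hl =>
      Function.update_of_ne (ne_of_mem_of_not_mem hl hi) _ _

theorem esymRem_mul_eq_sum_filter (n j : ℕ) (lam : Fin n → ℝ) (i : Fin n) :
    esymRem n j lam i * lam i =
      ∑ S ∈ Finset.powersetCard (j + 1) (Finset.univ : Finset (Fin n)) with i ∈ S,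
        ∏ l ∈ S, lam l := by
  rw [esymRem_eq_sum_filter, Finset.sum_mul]
  refine Finset.sum_nbij' (insert i) (fun S => S.erase i) ?_ ?_ ?_ ?_ ?_
  · intro S hS
    simp only [Finset.mem_filter, Finset.mem_powersetCard_univ] at hS ⊢
    simp [Finset.card_insert_of_notMem hS.2, hS.1]
  · intro S hS
    simp only [Finset.mem_filter, Finset.mem_powersetCard_univ] at hS ⊢
    simp [Finset.card_erase_of_mem hS.2, hS.1]
  · intro S hS
    exact Finset.erase_insert (Finset.mem_filter.1 hS).2
  · intro S hS
    exact Finset.insert_erase (Finset.mem_filter.1 hS).2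
  · intro S hS
    rw [Finset.prod_insert (Finset.mem_filter.1 hS).2, mul_comm]

theorem esym_succ (n j : ℕ) (lam : Fin n → ℝ) (i : Fin n) :
    esym n (j + 1) lam = esymRem n j lam i * lam i + esymRem n (j + 1) lam i := by
  rw [esymRem_mul_eq_sum_filter, esymRem_eq_sum_filter, Finset.sum_filter_add_sum_filter_not, esym]

theorem sum_esymRem_mul (n j : ℕ) (lam : Fin n → ℝ) :
    ∑ i, esymRem n j lam i * lam i = (j + 1) * esym n (j + 1) lam := by
  simp_rw [esymRem_mul_eq_sum_filter, Finset.sum_filter]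
  rw [Finset.sum_comm, esym, Finset.mul_sum]
  refine Finset.sum_congr rfl fun S hS => ?_
  rw [Finset.sum_ite_mem, Finset.univ_inter, Finset.sum_const,
    (Finset.mem_powersetCard.1 hS).2, nsmul_eq_mul]
  push_cast
  rfl

theorem esymRem_mul_le_esymRem_mul {n : ℕ} (j : ℕ) {lam : Fin n → ℝ} (h : ∀ i, 0 ≤ lam i)
    {i m : Fin n} (him : lam i ≤ lam m) :
    esymRem n j lam i * lam i ≤ esymRem n j lam m * lam m := by
  obtain rfl | hne := eq_or_ne i m
  · rfl
  have hi := esym_succ n j lam i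
  have hm := esym_succ n j lam m
  have hi' : esymRem n (j + 1) lam i = _ := esym_succ n j (Function.update lam i 0) m
  have hm' : esymRem n (j + 1) lam m = _ := esym_succ n j (Function.update lam m 0) i
  simp only [esymRem] at hi hm hi' hm' ⊢
  rw [Function.update_of_ne hne.symm] at hi'
  rw [Function.update_of_ne hne, Function.update_comm hne.symm] at hm'
  have hnn : 0 ≤ esym n j (Function.update (Function.update lam i 0) m 0) :=
    esym_nonneg j (update_zero_nonneg (update_zero_nonneg h i) m)
  nlinarith [mul_le_mul_of_nonneg_left him hnn]

theorem monotone_eigs {n : ℕ} (M : Matrix (Fin n) (Fin n) ℝ) : Monotone (eigs M) := by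
  unfold eigs
  split_ifs with h
  · exact Tuple.monotone_sort h.eigenvalues
  · exact monotone_const

theorem eigs_pos {n : ℕ} {M : Matrix (Fin n) (Fin n) ℝ} (hM : M.PosDef) (i : Fin n) :
    0 < eigs M i := by
  rw [eigs, dif_pos hM.isHermitian]
  exact hM.eigenvalues_pos _

/-- The maximum defining `H_k(A)` is attained at the largest eigenvalue, i.e.
`H_k(A) = σ_{k-1;n}(λ(A)) λ_n(A) / σ_k(λ(A))`; moreover `k/n ≤ H_k(A) < 1` for
`1 ≤ k ≤ n-1`, and `H_n(A) = 1`. -/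
theorem Hk_attained_at_largest_eigenvalue
    (n k : ℕ) (hk1 : 1 ≤ k) (hkn : k ≤ n)
    (A : Matrix (Fin n) (Fin n) ℝ) (hAsymm : A.IsSymm) (hApd : A.PosDef) :
    Hk n k A =
      esymRem n (k - 1) (eigs A) ⟨n - 1, by omega⟩ * eigs A ⟨n - 1, by omega⟩ /
        esym n k (eigs A) ∧
    (k ≤ n - 1 → (k : ℝ) / n ≤ Hk n k A ∧ Hk n k A < 1) ∧
    (k = n → Hk n k A = 1) := by
  obtain ⟨j, rfl⟩ : ∃ j, k = j + 1 := ⟨k - 1, by omega⟩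
  have hpos := eigs_pos hApd
  have hmono := monotone_eigs A
  set lam := eigs A with hlam
  set m : Fin n := ⟨n - 1, by omega⟩ with hm
  have hσ : 0 < esym n (j + 1) lam := esym_pos hkn hpos
  have hle (i : Fin n) : esymRem n j lam i * lam i ≤ esymRem n j lam m * lam m :=
    esymRem_mul_le_esymRem_mul j (fun l => (hpos l).le)
      (hmono (Fin.le_def.2 (by simp only [hm]; omega)))
  have hHk : Hk n (j + 1) A = esymRem n j lam m * lam m / esym n (j + 1) lam :=
    have : Nonempty (Fin n) := ⟨m⟩
    le_antisymm (ciSup_le fun i => div_le_div_of_nonneg_right (hle i) hσ.le)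
      (le_ciSup (f := fun i => esymRem n j lam i * lam i / esym n (j + 1) lam)
        (Set.finite_range _).bddAbove m)
  have hsucc := esym_succ n j lam m
  refine ⟨hHk, fun hk => ⟨?_, ?_⟩, fun hk => ?_⟩
  · have hn : (0 : ℝ) < n := by exact_mod_cast (by omega : 0 < n)
    rw [hHk, div_le_div_iff₀ hn hσ]
    have hsum := Finset.sum_le_card_nsmul Finset.univ _ _ fun i _ => hle i
    rw [sum_esymRem_mul, Finset.card_univ, Fintype.card_fin, nsmul_eq_mul] at hsum
    push_cast
    linarith
  · rw [hHk, div_lt_one hσ]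
    linarith [esymRem_pos hk hpos m]
  · have hzero : esymRem n (j + 1) lam m = 0 := hk ▸ esymRem_self n lam m
    rw [hHk, div_eq_one_iff_eq hσ.ne']
    linarith
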